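/- In any LTS, branching bisimilarity ↔_b is an equivalence relation: it is reflexive, symmetric, and transitive. -/

import Mathlib

/-- `TauCl tau` is the reflexive-transitive closure `↠τ` of the silent-step relation. -/
def TauCl {X : Type*} (tau : X → X → Prop) : X → X → Prop := Relation.ReflTransGen tau

/-- `R` is a branching bisimulation on the LTS `(tau, step)`
(including the symmetric variants of the two transfer conditions). -/
def IsBranchingBisim {X A : Type*} (tau : X → X → Prop) (step : A → X → X → Prop)
    (R : X → X → Prop) : Prop :=
  (∀ q p q', R q p → tau q q' →
    R q' p ∨ ∃ p' p'', TauCl tau p p' ∧ tau p' p'' ∧ R q p' ∧ R q' p'') ∧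
  (∀ q p q' a, R q p → step a q q' →
    ∃ p' p'', TauCl tau p p' ∧ step a p' p'' ∧ R q p' ∧ R q' p'') ∧
  (∀ q p p', R q p → tau p p' →
    R q p' ∨ ∃ q' q'', TauCl tau q q' ∧ tau q' q'' ∧ R q' p ∧ R q'' p') ∧
  (∀ q p p' a, R q p → step a p p' →
    ∃ q' q'', TauCl tau q q' ∧ step a q' q'' ∧ R q' p ∧ R q'' p')

/-- `q` and `p` are branching bisimilar: related by some branching bisimulation. -/
def BranchingBisimilar {X A : Type*} (tau : X → X → Prop) (step : A → X → X → Prop)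
    (q p : X) : Prop :=
  ∃ R, IsBranchingBisim tau step R ∧ R q p

open Relation

section Semi

variable {X A : Type*} {tau : X → X → Prop} {step : A → X → X → Prop}

/-- The left-to-right half of Basten's semi-branching bisimulations: a silent step may be matched
by a silent path whose last step is optional, as long as the source is related to its end. -/
def IsSemiSim (tau : X → X → Prop) (step : A → X → X → Prop) (R : X → X → Prop) : Prop :=
  (∀ q p q', R q p → tau q q' →
    ∃ p' p'', TauCl tau p p' ∧ ReflGen tau p' p'' ∧ R q p' ∧ R q' p'') ∧
  (∀ q p q' a, R q p → step a q q' →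
    ∃ p' p'', TauCl tau p p' ∧ step a p' p'' ∧ R q p' ∧ R q' p'')

/-- `R` is a semi-branching bisimulation. -/
def IsSemiBisim (tau : X → X → Prop) (step : A → X → X → Prop) (R : X → X → Prop) : Prop :=
  IsSemiSim tau step R ∧ IsSemiSim tau step (flip R)

/-- The union of all semi-branching bisimulations. -/
def SemiBisimilar (tau : X → X → Prop) (step : A → X → X → Prop) (q p : X) : Prop :=
  ∃ R, IsSemiBisim tau step R ∧ R q p

theorem IsBranchingBisim.isSemiBisim {R : X → X → Prop} (h : IsBranchingBisim tau step R) :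
    IsSemiBisim tau step R := by
  obtain ⟨h1, h2, h3, h4⟩ := h
  refine ⟨⟨fun q p q' hR ht => ?_, h2⟩, ⟨fun p q p' hR ht => ?_, fun p q p' a => h4 q p p' a⟩⟩
  · rcases h1 q p q' hR ht with h | ⟨x, y, hx, hy, hR1, hR2⟩
    · exact ⟨p, p, .refl, .refl, hR, h⟩
    · exact ⟨x, y, hx, .single hy, hR1, hR2⟩
  · rcases h3 q p p' hR ht with h | ⟨x, y, hx, hy, hR1, hR2⟩
    · exact ⟨q, q, .refl, .refl, hR, h⟩
    · exact ⟨x, y, hx, .single hy, hR1, hR2⟩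

theorem IsSemiSim.tauCl {R : X → X → Prop} (h : IsSemiSim tau step R) {q q' p : X}
    (hq : TauCl tau q q') (hR : R q p) : ∃ p', TauCl tau p p' ∧ R q' p' := by
  induction hq with
  | refl => exact ⟨p, .refl, hR⟩
  | tail _ ht ih =>
    obtain ⟨p₁, hp₁, hR₁⟩ := ih
    obtain ⟨p₂, p₃, h₂, h₃, -, hR₃⟩ := h.1 _ _ _ hR₁ ht
    exact ⟨p₃, (ReflTransGen.trans hp₁ h₂).trans h₃.to_reflTransGen, hR₃⟩

theorem IsSemiSim.comp {R S : X → X → Prop} (hR : IsSemiSim tau step R)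
    (hS : IsSemiSim tau step S) : IsSemiSim tau step (Comp R S) := by
  constructor
  · rintro q r q' ⟨p, hqp, hpr⟩ ht
    obtain ⟨p₁, p₂, hp₁, hp₂, hR₁, hR₂⟩ := hR.1 _ _ _ hqp ht
    obtain ⟨r₁, hr₁, hS₁⟩ := hS.tauCl hp₁ hpr
    cases hp₂ with
    | refl => exact ⟨r₁, r₁, hr₁, .refl, ⟨p₁, hR₁, hS₁⟩, ⟨p₁, hR₂, hS₁⟩⟩
    | single hp₂ =>
      obtain ⟨r₂, r₃, hr₂, hr₃, hS₂, hS₃⟩ := hS.1 _ _ _ hS₁ hp₂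
      exact ⟨r₂, r₃, ReflTransGen.trans hr₁ hr₂, hr₃, ⟨p₁, hR₁, hS₂⟩, ⟨p₂, hR₂, hS₃⟩⟩
  · rintro q r q' a ⟨p, hqp, hpr⟩ ht
    obtain ⟨p₁, p₂, hp₁, hp₂, hR₁, hR₂⟩ := hR.2 _ _ _ _ hqp ht
    obtain ⟨r₁, hr₁, hS₁⟩ := hS.tauCl hp₁ hpr
    obtain ⟨r₂, r₃, hr₂, hr₃, hS₂, hS₃⟩ := hS.2 _ _ _ _ hS₁ hp₂
    exact ⟨r₂, r₃, ReflTransGen.trans hr₁ hr₂, hr₃, ⟨p₁, hR₁, hS₂⟩, ⟨p₂, hR₂, hS₃⟩⟩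

theorem SemiBisimilar.symm {q p : X} :
    SemiBisimilar tau step q p → SemiBisimilar tau step p q :=
  fun ⟨R, h, hR⟩ => ⟨flip R, ⟨h.2, h.1⟩, hR⟩

theorem SemiBisimilar.trans {q p r : X} :
    SemiBisimilar tau step q p → SemiBisimilar tau step p r → SemiBisimilar tau step q r :=
  fun ⟨R, hR, hqp⟩ ⟨S, hS, hpr⟩ =>
    ⟨Comp R S, ⟨hR.1.comp hS.1, flip_comp (r := R) (p := S) ▸ hS.2.comp hR.2⟩, p, hqp, hpr⟩

theorem isSemiSim_semiBisimilar : IsSemiSim tau step (SemiBisimilar tau step) := by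
  constructor
  · rintro q p q' ⟨R, h, hR⟩ ht
    obtain ⟨x, y, hx, hy, h₁, h₂⟩ := h.1.1 _ _ _ hR ht
    exact ⟨x, y, hx, hy, ⟨R, h, h₁⟩, ⟨R, h, h₂⟩⟩
  · rintro q p q' a ⟨R, h, hR⟩ ht
    obtain ⟨x, y, hx, hy, h₁, h₂⟩ := h.1.2 _ _ _ _ hR ht
    exact ⟨x, y, hx, hy, ⟨R, h, h₁⟩, ⟨R, h, h₂⟩⟩

/-- The stuttering property: a silent path whose ends are both related to `q` is related to `q`
throughout. -/
theorem SemiBisimilar.stuttering {q p p₁ p₂ : X} (h₁ : SemiBisimilar tau step q p₁)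
    (h₂ : SemiBisimilar tau step q p₂) (hp₁ : TauCl tau p₁ p) (hp₂ : TauCl tau p p₂) :
    SemiBisimilar tau step q p := by
  have hB := isSemiSim_semiBisimilar (tau := tau) (step := step)
  let C : X → X → Prop := fun q p => ∃ p₁ p₂, SemiBisimilar tau step q p₁ ∧
    SemiBisimilar tau step q p₂ ∧ TauCl tau p₁ p ∧ TauCl tau p p₂
  have hC : ∀ {q p}, SemiBisimilar tau step q p → C q p := fun h => ⟨_, _, h, h, .refl, .refl⟩
  refine ⟨C, ⟨⟨?_, ?_⟩, ⟨?_, ?_⟩⟩, p₁, p₂, h₁, h₂, hp₁, hp₂⟩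
  · rintro q p q' ⟨p₁, p₂, -, h₂, -, hp₂⟩ ht
    obtain ⟨x, y, hx, hy, hqx, hqy⟩ := hB.1 _ _ _ h₂ ht
    exact ⟨x, y, ReflTransGen.trans hp₂ hx, hy, hC hqx, hC hqy⟩
  · rintro q p q' a ⟨p₁, p₂, -, h₂, -, hp₂⟩ ht
    obtain ⟨x, y, hx, hy, hqx, hqy⟩ := hB.2 _ _ _ _ h₂ ht
    exact ⟨x, y, ReflTransGen.trans hp₂ hx, hy, hC hqx, hC hqy⟩
  · rintro p q p' ⟨p₁, p₂, h₁, -, hp₁, -⟩ ht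
    obtain ⟨q₁, hq₁, hpq₁⟩ := hB.tauCl hp₁ h₁.symm
    obtain ⟨x, y, hx, hy, hpx, hpy⟩ := hB.1 _ _ _ hpq₁ ht
    exact ⟨x, y, ReflTransGen.trans hq₁ hx, hy, hC hpx.symm, hC hpy.symm⟩
  · rintro p q p' a ⟨p₁, p₂, h₁, -, hp₁, -⟩ ht
    obtain ⟨q₁, hq₁, hpq₁⟩ := hB.tauCl hp₁ h₁.symm
    obtain ⟨x, y, hx, hy, hpx, hpy⟩ := hB.2 _ _ _ _ hpq₁ ht
    exact ⟨x, y, ReflTransGen.trans hq₁ hx, hy, hC hpx.symm, hC hpy.symm⟩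

theorem SemiBisimilar.tau_step {q p q' : X} (h : SemiBisimilar tau step q p) (ht : tau q q') :
    SemiBisimilar tau step q' p ∨ ∃ p' p'', TauCl tau p p' ∧ tau p' p'' ∧
      SemiBisimilar tau step q p' ∧ SemiBisimilar tau step q' p'' := by
  obtain ⟨x, y, hx, hy, hqx, hqy⟩ := isSemiSim_semiBisimilar.1 _ _ _ h ht
  cases hy with
  | single hy => exact .inr ⟨x, y, hx, hy, hqx, hqy⟩
  | refl =>
    rcases ReflTransGen.cases_tail hx with rfl | ⟨z, hz, hzx⟩
    · exact .inl hqy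
    · exact .inr ⟨z, x, hz, hzx, h.stuttering hqx hz (ReflTransGen.single hzx), hqy⟩

theorem isBranchingBisim_semiBisimilar :
    IsBranchingBisim tau step (SemiBisimilar tau step) := by
  refine ⟨fun q p q' h ht => h.tau_step ht, isSemiSim_semiBisimilar.2, fun q p p' h ht => ?_,
    fun q p p' a h ht => ?_⟩
  · rcases h.symm.tau_step ht with h' | ⟨x, y, hx, hy, h₁, h₂⟩
    · exact .inl h'.symm
    · exact .inr ⟨x, y, hx, hy, h₁.symm, h₂.symm⟩
  · obtain ⟨x, y, hx, hy, h₁, h₂⟩ := isSemiSim_semiBisimilar.2 _ _ _ _ h.symm ht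
    exact ⟨x, y, hx, hy, h₁.symm, h₂.symm⟩

theorem branchingBisimilar_iff_semiBisimilar {q p : X} :
    BranchingBisimilar tau step q p ↔ SemiBisimilar tau step q p :=
  ⟨fun ⟨R, h, hR⟩ => ⟨R, h.isSemiBisim, hR⟩, fun h => ⟨_, isBranchingBisim_semiBisimilar, h⟩⟩

theorem isBranchingBisim_eq : IsBranchingBisim tau step Eq := by
  refine ⟨?_, ?_, ?_, ?_⟩
  · rintro q _ q' rfl ht
    exact .inr ⟨q, q', .refl, ht, rfl, rfl⟩
  · rintro q _ q' a rfl ht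
    exact ⟨q, q', .refl, ht, rfl, rfl⟩
  · rintro q _ q' rfl ht
    exact .inr ⟨q, q', .refl, ht, rfl, rfl⟩
  · rintro q _ q' a rfl ht
    exact ⟨q, q', .refl, ht, rfl, rfl⟩

end Semi

theorem branchingBisimilar_equivalence {X A : Type*} (tau : X → X → Prop)
    (step : A → X → X → Prop) :
    Equivalence (BranchingBisimilar tau step) where
  refl _ := ⟨Eq, isBranchingBisim_eq, rfl⟩
  symm h := branchingBisimilar_iff_semiBisimilar.2 (branchingBisimilar_iff_semiBisimilar.1 h).symm
  trans h₁ h₂ := branchingBisimilar_iff_semiBisimilar.2 <|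
    (branchingBisimilar_iff_semiBisimilar.1 h₁).trans (branchingBisimilar_iff_semiBisimilar.1 h₂)
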